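/- For a finite simple graph H define j(H) := 2^{iso(H)} · ∏_{uv ∈ E(H)} (2^{d_u} + 2^{d_v} − 1)^{1/(d_u d_v)}, where d_v is the degree of v in H and iso(H) is the number of isolated vertices of H. Let G be a connected bipartite finite simple graph with at least two vertices, and let w be a vertex of G of maximum degree. Then j(G − w) + j(G − w − N(w)) ≤ j(G), where G − w is the graph G with the vertex w (and all incident edges) deleted, and G − w − N(w) is the graph G with w and all neighbors of w (and all incident edges) deleted. -/

import Mathlib

open Finset
open scoped Classical

/-- The number of isolated vertices (vertices of degree `0`) of `H`. -/
noncomputable def numIsolated {V : Type*} [Fintype V] (H : SimpleGraph V) : ℕ :=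
  (Finset.univ.filter fun v : V => H.degree v = 0).card

/-- The weight `(2^{d_u} + 2^{d_v} - 1)^{1/(d_u d_v)}` attached to the edge `uv`,
as a symmetric function on `Sym2 V`. -/
noncomputable def edgeWeight {V : Type*} [Fintype V] (H : SimpleGraph V) : Sym2 V → ℝ :=
  Sym2.lift ⟨fun u v =>
      ((2:ℝ) ^ H.degree u + (2:ℝ) ^ H.degree v - 1) ^
        ((1:ℝ) / ((H.degree u : ℝ) * (H.degree v : ℝ))),
    fun u v => by
      simp only []
      rw [add_comm ((2:ℝ) ^ H.degree u), mul_comm ((H.degree u : ℝ))]⟩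

/-- `j(H) := 2^{iso(H)} ∏_{uv ∈ E(H)} (2^{d_u} + 2^{d_v} - 1)^{1/(d_u d_v)}`. -/
noncomputable def jval {V : Type*} [Fintype V] (H : SimpleGraph V) : ℝ :=
  2 ^ numIsolated H * ∏ e ∈ H.edgeFinset, edgeWeight H e

/-- A convex sequence lies below its chord on `[0, d]`. -/
lemma convex_seq_le_chord (l : ℕ → ℝ) (h : ∀ n, 2 * l (n + 1) ≤ l n + l (n + 2))
    {k d : ℕ} (hk : k ≤ d) : (d : ℝ) * l k ≤ ((d : ℝ) - k) * l 0 + k * l d := by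
  have consec : ∀ n : ℕ, ((n : ℝ) + 1) * l n ≤ l 0 + n * l (n + 1) := by
    intro n
    induction n with
    | zero => simp
    | succ n ih =>
      have := mul_le_mul_of_nonneg_left (h n) (by positivity : (0 : ℝ) ≤ (n : ℝ) + 1)
      push_cast
      linarith
  induction d, hk using Nat.le_induction with
  | base => simp
  | succ d hkd ih =>
    rcases Nat.eq_zero_or_pos d with rfl | hd
    · obtain rfl : k = 0 := by omega
      simp
    · have hd' : (0 : ℝ) < d := by exact_mod_cast hd
      have h1 := mul_le_mul_of_nonneg_left ih (by positivity : (0 : ℝ) ≤ (d : ℝ) + 1)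
      have h2 := mul_le_mul_of_nonneg_left (consec d) (Nat.cast_nonneg (α := ℝ) k)
      refine le_of_mul_le_mul_left ?_ hd'
      push_cast
      linarith

/-- A log-convex sequence of positive reals satisfies the chord inequality multiplicatively. -/
lemma log_convex_seq_le_chord (a : ℕ → ℝ) (hpos : ∀ n, 0 < a n)
    (h : ∀ n, a (n + 1) ^ 2 ≤ a n * a (n + 2)) {k d : ℕ} (hk : k ≤ d) :
    a k ^ d ≤ a 0 ^ (d - k) * a d ^ k := by
  have := convex_seq_le_chord (fun n => Real.log (a n)) (fun n => by
    have := Real.log_le_log (pow_pos (hpos _) 2) (h n)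
    rwa [Real.log_pow, Real.log_mul (hpos _).ne' (hpos _).ne'] at this) hk
  have h0 := hpos 0
  have hk' := hpos k
  have hd := hpos d
  rw [← Real.log_le_log_iff (by positivity) (by positivity), Real.log_mul (by positivity)
    (by positivity), Real.log_pow, Real.log_pow, Real.log_pow, Nat.cast_sub hk]
  exact this

/-- Hölder's inequality for two products, in normalised form. -/
lemma prod_add_prod_le_prod {ι : Type*} (s : Finset ι) (hs : s.Nonempty) (p q r : ι → ℝ)
    (hp : ∀ i ∈ s, 0 ≤ p i) (hq : ∀ i ∈ s, 0 ≤ q i) (hr : ∀ i ∈ s, 0 < r i)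
    (h : ∀ i ∈ s, p i ^ #s + q i ^ #s ≤ r i ^ #s) :
    ∏ i ∈ s, p i + ∏ i ∈ s, q i ≤ ∏ i ∈ s, r i := by
  have hn : (0 : ℝ) < #s := by exact_mod_cast hs.card_pos
  have key : ∀ f : ι → ℝ, (∀ i ∈ s, 0 ≤ f i) →
      ∏ i ∈ s, f i ≤ (∏ i ∈ s, r i) * ∑ i ∈ s, (#s : ℝ)⁻¹ * (f i / r i) ^ #s := by
    intro f hf
    have := Real.geom_mean_le_arith_mean_weighted s (fun _ => (#s : ℝ)⁻¹)
      (fun i => (f i / r i) ^ #s) (fun _ _ => by positivity)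
      (by simp [hn.ne']) (fun i hi => pow_nonneg (div_nonneg (hf i hi) (hr i hi).le) _)
    rw [Finset.prod_congr rfl (fun i hi => Real.pow_rpow_inv_natCast
      (div_nonneg (hf i hi) (hr i hi).le) hs.card_pos.ne'), Finset.prod_div_distrib,
      div_le_iff₀ (Finset.prod_pos hr)] at this
    linarith
  have hsum : ∑ i ∈ s, (#s : ℝ)⁻¹ * (p i / r i) ^ #s + ∑ i ∈ s, (#s : ℝ)⁻¹ * (q i / r i) ^ #s
      ≤ 1 := by
    rw [← Finset.sum_add_distrib]
    calc _ ≤ ∑ i ∈ s, (#s : ℝ)⁻¹ := by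
          refine Finset.sum_le_sum fun i hi => ?_
          rw [← mul_add, div_pow, div_pow, ← add_div]
          exact mul_le_of_le_one_right (by positivity)
            ((div_le_one (pow_pos (hr i hi) _)).2 (h i hi))
      _ = 1 := by simp [hn.ne']
  have h1 := key p hp
  have h2 := key q hq
  have h3 := mul_le_mul_of_nonneg_left hsum (Finset.prod_pos hr).le
  linarith

/-- `s ↦ (1 + s) ^ t - 1` is log-convex along doublings of `s`. -/
lemma one_add_rpow_sub_one_sq_le {t s : ℝ} (ht : 1 ≤ t) (hs : 0 < s) :
    ((1 + 2 * s) ^ t - 1) ^ 2 ≤ ((1 + s) ^ t - 1) * ((1 + 4 * s) ^ t - 1) := by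
  have hφ : 0 < (1 + s) ^ t - 1 :=
    sub_pos.2 (Real.one_lt_rpow (by linarith) (by linarith))
  set c := ((1 + 2 * s) ^ t - 1) / ((1 + s) ^ t - 1) with hc
  let F : ℝ → ℝ := fun x => ((1 + 2 * x) ^ t - 1) - c * ((1 + x) ^ t - 1)
  have hF : ∀ x, 0 ≤ x → HasDerivAt F
      (2 * t * (1 + 2 * x) ^ (t - 1) - c * (t * (1 + x) ^ (t - 1))) x := by
    intro x hx
    have h1 : HasDerivAt (fun x : ℝ => 1 + 2 * x) 2 x := by
      simpa using ((hasDerivAt_id x).const_mul 2).const_add 1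
    have h2 : HasDerivAt (fun x : ℝ => 1 + x) 1 x := by
      simpa using (hasDerivAt_id x).const_add 1
    have h3 := (h1.rpow_const (p := t) (Or.inr ht)).sub_const 1
    have h4 := ((h2.rpow_const (p := t) (Or.inr ht)).sub_const 1).const_mul c
    exact (h3.sub h4).congr_deriv (by ring)
  have hF0 : F 0 = 0 := by simp [F]
  have hFs : F s = 0 := by simp only [F, hc]; field_simp; ring
  obtain ⟨ξ, ⟨hξ0, hξs⟩, hξ⟩ := exists_hasDerivAt_eq_zero hs
    (fun x hx => (hF x hx.1).continuousAt.continuousWithinAt) (hF0.trans hFs.symm)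
    (fun x hx => hF x hx.1.le)
  have hmono : MonotoneOn F (Set.Ici ξ) := by
    refine monotoneOn_of_deriv_nonneg (convex_Ici ξ)
      (fun x hx => (hF x (hξ0.le.trans hx)).continuousAt.continuousWithinAt)
      (fun x hx => ?_) (fun x hx => ?_)
    · rw [interior_Ici] at hx
      exact (hF x (hξ0.trans hx).le).differentiableAt.differentiableWithinAt
    · rw [interior_Ici] at hx
      have hx' : ξ < x := hx
      have hx0 : 0 < x := hξ0.trans hx
      rw [(hF x hx0.le).deriv]
      have hle : (1 + 2 * ξ) ^ (t - 1) * (1 + x) ^ (t - 1) ≤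
          (1 + 2 * x) ^ (t - 1) * (1 + ξ) ^ (t - 1) := by
        rw [← Real.mul_rpow (by positivity) (by positivity),
          ← Real.mul_rpow (by positivity) (by positivity)]
        exact Real.rpow_le_rpow (by positivity) (by nlinarith) (by linarith)
      have hpos : 0 < (1 + ξ) ^ (t - 1) := Real.rpow_pos_of_pos (by linarith) _
      refine nonneg_of_mul_nonneg_left (b := (1 + ξ) ^ (t - 1)) ?_ hpos
      have e : c * (t * (1 + ξ) ^ (t - 1)) = 2 * t * (1 + 2 * ξ) ^ (t - 1) := by linarith
      have := mul_le_mul_of_nonneg_left hle (by linarith : 0 ≤ 2 * t)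
      calc (0 : ℝ) ≤ 2 * t * ((1 + 2 * x) ^ (t - 1) * (1 + ξ) ^ (t - 1)) -
            (2 * t * (1 + 2 * ξ) ^ (t - 1)) * (1 + x) ^ (t - 1) := by linarith
        _ = _ := by rw [← e]; ring
  have h2s : 0 ≤ F (2 * s) := by
    rw [← hFs]
    exact hmono hξs.le (by simp only [Set.mem_Ici]; linarith) (by linarith)
  have : c * ((1 + 2 * s) ^ t - 1) ≤ (1 + 4 * s) ^ t - 1 := by
    have e : (1 : ℝ) + 2 * (2 * s) = 1 + 4 * s := by ring
    simp only [F, e] at h2s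
    linarith
  rw [hc, div_mul_eq_mul_div, div_le_iff₀ hφ] at this
  linarith

/-- The chord inequality for the log-convex sequence `n ↦ 1 + ((1 + 2 ^ n z) ^ t - 1) / 2 ^ n`. -/
lemma one_add_rpow_avg_pow_le {t z : ℝ} (ht : 1 ≤ t) (hz : 0 < z) {n : ℕ} (hn : 1 ≤ n) :
    ((1 + (1 + 2 * z) ^ t) / 2) ^ n ≤
      ((1 + z) ^ t) ^ (n - 1) * (1 + ((1 + 2 ^ n * z) ^ t - 1) / 2 ^ n) := by
  set c : ℕ → ℝ := fun n => ((1 + 2 ^ n * z) ^ t - 1) / 2 ^ n with hc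
  have hcpos : ∀ n, 0 < c n := fun n => by
    have : 0 < 2 ^ n * z := by positivity
    exact div_pos (sub_pos.2 (Real.one_lt_rpow (by linarith) (by linarith))) (by positivity)
  have hclog : ∀ n, c (n + 1) ^ 2 ≤ c n * c (n + 2) := fun n => by
    have := one_add_rpow_sub_one_sq_le ht (by positivity : 0 < 2 ^ n * z)
    simp only [hc, div_pow, div_mul_div_comm]
    have e1 : (2 : ℝ) ^ (n + 1) * z = 2 * (2 ^ n * z) := by ring
    have e2 : (2 : ℝ) ^ (n + 2) * z = 4 * (2 ^ n * z) := by ring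
    have e3 : (2 : ℝ) ^ n * 2 ^ (n + 2) = (2 ^ (n + 1)) ^ 2 := by ring
    rw [e1, e2, e3]
    gcongr
  have := log_convex_seq_le_chord (fun n => 1 + c n) (fun n => by linarith [hcpos n])
    (fun n => by
      have h0 := hcpos n
      have h1 := hcpos (n + 1)
      have h2 := hcpos (n + 2)
      have h3 := hclog n
      have : 2 * c (n + 1) ≤ c n + c (n + 2) := by
        refine abs_le_of_sq_le_sq' ?_ (by positivity) |>.2
        nlinarith [sq_nonneg (c n - c (n + 2))]
      nlinarith) hn
  have e0 : 1 + c 0 = (1 + z) ^ t := by simp [hc]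
  have e1 : 1 + c 1 = (1 + (1 + 2 * z) ^ t) / 2 := by simp only [hc, pow_one]; ring
  simpa only [e0, e1, pow_one] using this

/-- The weight of an edge whose endpoints have degrees `a` and `b`. -/
noncomputable def degWeight (a b : ℕ) : ℝ :=
  ((2 : ℝ) ^ a + 2 ^ b - 1) ^ ((1 : ℝ) / ((a : ℝ) * b))

lemma degWeight_base_pos (a b : ℕ) : (0 : ℝ) < 2 ^ a + 2 ^ b - 1 := by
  have h1 : (1 : ℝ) ≤ 2 ^ a := one_le_pow₀ (by norm_num)
  have h2 : (1 : ℝ) ≤ 2 ^ b := one_le_pow₀ (by norm_num)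
  linarith

lemma degWeight_pos (a b : ℕ) : 0 < degWeight a b :=
  Real.rpow_pos_of_pos (degWeight_base_pos a b) _

lemma degWeight_comm (a b : ℕ) : degWeight a b = degWeight b a := by
  rw [degWeight, degWeight, add_comm ((2 : ℝ) ^ a), mul_comm (a : ℝ)]

lemma local_rpow_le {d x D : ℕ} (hd : 1 ≤ d) (hx : 1 ≤ x) (hxD : x ≤ D) :
    (((2 : ℝ) ^ (d - 1) + 2 ^ x - 1) ^ ((D : ℝ) / x) + ((2 : ℝ) ^ (d - 1)) ^ ((D : ℝ) / x)) ^ d ≤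
      (2 ^ D + 2 ^ d - 1) * (((2 : ℝ) ^ d + 2 ^ x - 1) ^ ((D : ℝ) / x)) ^ (d - 1) := by
  obtain ⟨m, rfl⟩ : ∃ m, d = m + 1 := ⟨d - 1, by omega⟩
  have hx' : (0 : ℝ) < x := by exact_mod_cast hx
  set t : ℝ := (D : ℝ) / x with ht
  have ht1 : 1 ≤ t := by
    rw [ht, one_le_div hx']
    exact_mod_cast hxD
  have hX : (1 : ℝ) < 2 ^ x := one_lt_pow₀ (by norm_num) (by omega)
  set z : ℝ := (2 ^ x - 1) / 2 ^ (m + 1) with hz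
  have hzpos : 0 < z := div_pos (by linarith) (by positivity)
  have hy : (2 : ℝ) ^ (m + 1) * z = 2 ^ x - 1 := by rw [hz]; field_simp
  have key := one_add_rpow_avg_pow_le ht1 hzpos hd
  simp only [Nat.add_sub_cancel] at key ⊢
  have e1 : (2 : ℝ) ^ m + 2 ^ x - 1 = 2 ^ m * (1 + 2 * z) := by rw [add_sub_assoc, ← hy]; ring
  have e2 : (2 : ℝ) ^ (m + 1) + 2 ^ x - 1 = 2 ^ (m + 1) * (1 + z) := by
    rw [add_sub_assoc, ← hy]; ring
  have e3 : (2 : ℝ) ^ D = (1 + 2 ^ (m + 1) * z) ^ t := by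
    rw [hy, add_sub_cancel, ← Real.rpow_natCast 2 x, ← Real.rpow_mul (by norm_num), ht,
      mul_div_cancel₀ _ hx'.ne', Real.rpow_natCast]
  have e4 : (((2 : ℝ) ^ m) ^ t) ^ (m + 1) = (((2 : ℝ) ^ (m + 1)) ^ t) ^ m := by
    simp only [← Real.rpow_natCast, ← Real.rpow_mul (zero_le_two : (0 : ℝ) ≤ 2)]
    congr 1
    ring
  rw [e1, e2, e3, Real.mul_rpow (by positivity) (by positivity),
    Real.mul_rpow (by positivity) (by positivity)]
  calc _ = ((2 : ℝ) ^ (m + 1) * (((2 : ℝ) ^ m) ^ t) ^ (m + 1)) *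
        ((1 + (1 + 2 * z) ^ t) / 2) ^ (m + 1) := by
        rw [← mul_pow, ← mul_pow]; congr 1; ring
    _ ≤ ((2 : ℝ) ^ (m + 1) * (((2 : ℝ) ^ m) ^ t) ^ (m + 1)) * (((1 + z) ^ t) ^ m *
        (1 + ((1 + 2 ^ (m + 1) * z) ^ t - 1) / 2 ^ (m + 1))) := by gcongr
    _ = _ := by
        rw [e4, mul_pow]
        field_simp
        ring

/-- Contribution of a neighbour of the deleted vertex: its other neighbours `v ∈ T` have
degrees `x v`. -/
lemma neighbor_contribution {ι : Type*} (T : Finset ι) (x : ι → ℕ) {D : ℕ}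
    (hx : ∀ v ∈ T, 1 ≤ x v) (hxD : ∀ v ∈ T, x v ≤ D) (hD : 1 ≤ D) :
    ((if #T = 0 then 2 else 1) * ∏ v ∈ T, degWeight #T (x v)) ^ D +
        (∏ v ∈ T, (2 : ℝ) ^ ((1 : ℝ) / x v)) ^ D ≤
      (degWeight D (#T + 1) * ∏ v ∈ T, degWeight (#T + 1) (x v)) ^ D := by
  have hD' : (0 : ℝ) < D := by exact_mod_cast hD
  rcases T.eq_empty_or_nonempty with rfl | hT
  · simp only [card_empty, if_true, prod_empty, degWeight, one_pow, mul_one, zero_add, pow_one,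
      Nat.cast_one]
    have h1 : (1 : ℝ) ≤ 2 ^ D := one_le_pow₀ (by norm_num)
    rw [one_div, Real.rpow_inv_natCast_pow (by linarith) (by omega)]
    linarith
  · have hn := hT.card_pos
    set n := #T with hndef
    have hn' : (0 : ℝ) < n := by exact_mod_cast hn
    rw [if_neg hn.ne', one_mul, mul_pow, ← Finset.prod_pow, ← Finset.prod_pow, ← Finset.prod_pow]
    set A : ℝ := 2 ^ D + 2 ^ (n + 1) - 1 with hA
    have hApos : 0 < A := degWeight_base_pos D (n + 1)
    have e0 : degWeight D (n + 1) ^ D = ∏ v ∈ T, A ^ ((1 : ℝ) / ((n + 1) * n)) := by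
      rw [Finset.prod_const, ← hndef, degWeight, ← hA, ← Real.rpow_natCast, ← Real.rpow_natCast,
        ← Real.rpow_mul hApos.le, ← Real.rpow_mul hApos.le]
      congr 1
      push_cast
      field_simp
    rw [e0, ← Finset.prod_mul_distrib]
    refine prod_add_prod_le_prod T hT _ _ _ (fun v _ => (pow_pos (degWeight_pos _ _) _).le)
      (fun v _ => by positivity)
      (fun v _ => mul_pos (Real.rpow_pos_of_pos hApos _) (pow_pos (degWeight_pos _ _) _)) ?_
    intro v hv
    have hxv : (0 : ℝ) < x v := by exact_mod_cast hx v hv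
    rw [← hndef]
    have hb1 := degWeight_base_pos n (x v)
    have hb2 := degWeight_base_pos (n + 1) (x v)
    have main := local_rpow_le (d := n + 1) (by omega) (hx v hv) (hxD v hv)
    simp only [Nat.add_sub_cancel] at main
    rw [← hA] at main
    have e1 : (degWeight n (x v) ^ D) ^ n =
        ((2 : ℝ) ^ n + 2 ^ x v - 1) ^ ((D : ℝ) / x v) := by
      rw [degWeight, ← Real.rpow_natCast, ← Real.rpow_natCast, ← Real.rpow_mul hb1.le,
        ← Real.rpow_mul hb1.le]
      congr 1
      field_simp
    have e2 : (((2 : ℝ) ^ ((1 : ℝ) / x v)) ^ D) ^ n = ((2 : ℝ) ^ n) ^ ((D : ℝ) / x v) := by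
      simp only [← Real.rpow_natCast, ← Real.rpow_mul (zero_le_two : (0 : ℝ) ≤ 2)]
      congr 1
      field_simp
    rw [e1, e2]
    refine le_of_pow_le_pow_left₀ n.succ_ne_zero
      (pow_nonneg (mul_pos (Real.rpow_pos_of_pos hApos _)
        (pow_pos (degWeight_pos _ _) _)).le _) (main.trans_eq ?_)
    rw [mul_pow, mul_pow]
    congr 1
    · simp only [← Real.rpow_natCast, ← Real.rpow_mul hApos.le]
      conv_lhs => rw [← Real.rpow_one A]
      congr 1
      push_cast
      field_simp
    · simp only [degWeight, ← Real.rpow_natCast] at hb2 ⊢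
      simp only [← Real.rpow_mul hb2.le]
      congr 1
      push_cast
      field_simp

/-- Contribution of a vertex of degree `d` whose remaining neighbours `u ∈ U` have
degrees `x u`. -/
lemma reduced_vertex_contribution {ι : Type*} (U : Finset ι) (x : ι → ℕ) {d : ℕ}
    (hx : ∀ u ∈ U, 1 ≤ x u) (hd : 1 ≤ d) (hU : #U ≤ d) :
    (if #U = 0 then 2 else 1) * ∏ u ∈ U, degWeight #U (x u) ≤
      ((2 : ℝ) ^ ((1 : ℝ) / d)) ^ (d - #U) * ∏ u ∈ U, degWeight d (x u) := by
  have hd' : (0 : ℝ) < d := by exact_mod_cast hd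
  rcases U.eq_empty_or_nonempty with rfl | hne
  · simp only [card_empty, if_true, prod_empty, mul_one, Nat.sub_zero, one_div]
    rw [Real.rpow_inv_natCast_pow (by norm_num) (by omega)]
  have hk := hne.card_pos
  set k := #U with hkdef
  have hk' : (0 : ℝ) < k := by exact_mod_cast hk
  have e : ((2 : ℝ) ^ ((1 : ℝ) / d)) ^ (d - k) = ∏ u ∈ U, (2 : ℝ) ^ ((1 : ℝ) / k - 1 / d) := by
    rw [Finset.prod_const, ← hkdef]
    simp only [← Real.rpow_natCast, ← Real.rpow_mul (zero_le_two : (0 : ℝ) ≤ 2), Nat.cast_sub hU]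
    congr 1
    field_simp
  rw [if_neg hk.ne', one_mul, e, ← Finset.prod_mul_distrib]
  refine Finset.prod_le_prod (fun u _ => (degWeight_pos _ _).le) fun u hu => ?_
  have hxu : (0 : ℝ) < x u := by exact_mod_cast hx u hu
  have main := convex_seq_le_chord (fun n => Real.log ((2 : ℝ) ^ n + 2 ^ x u - 1)) (fun n => by
    have h0 := degWeight_base_pos n (x u)
    have h1 := degWeight_base_pos (n + 1) (x u)
    have h2 := degWeight_base_pos (n + 2) (x u)
    have hX : (1 : ℝ) ≤ 2 ^ x u := one_le_pow₀ (by norm_num)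
    have hn : (0 : ℝ) < 2 ^ n := by positivity
    have := Real.log_le_log (pow_pos h1 2)
      (show _ ≤ ((2 : ℝ) ^ n + 2 ^ x u - 1) * (2 ^ (n + 2) + 2 ^ x u - 1) by
        rw [pow_succ (2 : ℝ) n, pow_add]
        nlinarith [mul_nonneg hn.le (sub_nonneg.2 hX)])
    rwa [Real.log_pow, Real.log_mul h0.ne' h2.ne'] at this) hU
  have hb1 := degWeight_base_pos k (x u)
  have hb2 := degWeight_base_pos d (x u)
  rw [← Real.log_le_log_iff (degWeight_pos _ _) (mul_pos (by positivity) (degWeight_pos _ _)),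
    Real.log_mul (by positivity) (degWeight_pos _ _).ne', degWeight, degWeight,
    Real.log_rpow hb1, Real.log_rpow hb2, Real.log_rpow (by norm_num)]
  simp only [pow_zero, add_sub_cancel_left, Real.log_pow] at main
  rw [← mul_le_mul_iff_right₀ (by positivity : (0 : ℝ) < k * d * x u)]
  generalize Real.log ((2 : ℝ) ^ k + 2 ^ x u - 1) = L at main ⊢
  generalize Real.log ((2 : ℝ) ^ d + 2 ^ x u - 1) = M at main ⊢
  have e1 : (k : ℝ) * d * x u * (1 / (k * x u) * L) = d * L := by field_simp
  have e2 : (k : ℝ) * d * x u * ((1 / k - 1 / d) * Real.log 2 + 1 / (d * x u) * M) =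
      (d - k) * (x u * Real.log 2) + k * M := by field_simp
  rw [e1, e2]
  exact main

lemma degree_pos_of_connected {V : Type*} [Fintype V] {G : SimpleGraph V} (hconn : G.Connected)
    (hcard : 2 ≤ Fintype.card V) (v : V) : 1 ≤ G.degree v := by
  have : Nontrivial V := Fintype.one_lt_card_iff_nontrivial.1 hcard
  exact hconn.preconnected.degree_pos_of_nontrivial v

/-- A product over the edges of a bipartite graph, ordered from one class of the bipartition. -/
lemma prod_edgeFinset_eq {V : Type*} [Fintype V] (H : SimpleGraph V) (B : Set V)
    (hB : ∀ u v, H.Adj u v → (u ∈ B ↔ v ∉ B)) (f : Sym2 V → ℝ) :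
    ∏ e ∈ H.edgeFinset, f e = ∏ v with v ∈ B, ∏ u with H.Adj v u, f s(v, u) := by
  rw [Finset.prod_sigma']
  symm
  refine Finset.prod_bij (fun p _ => s(p.1, p.2)) ?_ ?_ ?_ (fun _ _ => rfl)
  · rintro ⟨v, u⟩ h
    simp only [mem_sigma, mem_filter, mem_univ, true_and] at h
    simpa using h.2
  · rintro ⟨v, u⟩ h ⟨v', u'⟩ h' e
    simp only [mem_sigma, mem_filter, mem_univ, true_and] at h h'
    rcases Sym2.eq_iff.1 e with ⟨h1, h2⟩ | ⟨h1, h2⟩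
    · simp only at h1 h2
      rw [h1, h2]
    · simp only at h1 h2
      subst h1 h2
      exact absurd h'.1 ((hB _ _ h.2).1 h.1)
  · intro e
    induction e using Sym2.ind with
    | _ a b =>
      intro h
      rw [SimpleGraph.mem_edgeFinset, SimpleGraph.mem_edgeSet] at h
      by_cases ha : a ∈ B
      · exact ⟨⟨a, b⟩, by simp [ha, h], rfl⟩
      · have hb : b ∈ B := (hB b a h.symm).2 ha
        exact ⟨⟨b, a⟩, by simp [hb, h.symm], Sym2.eq_swap⟩

lemma jval_eq {V : Type*} [Fintype V] (H : SimpleGraph V) (B : Set V)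
    (hB : ∀ u v, H.Adj u v → (u ∈ B ↔ v ∉ B)) :
    jval H = (∏ v : V, if H.degree v = 0 then 2 else 1) *
      ∏ v with v ∈ B, ∏ u with H.Adj v u, degWeight (H.degree v) (H.degree u) := by
  rw [jval, numIsolated, prod_edgeFinset_eq H B hB, Finset.prod_ite, Finset.prod_const,
    Finset.prod_const_one, mul_one]
  rfl

lemma degree_induce_eq_card {V : Type*} [Fintype V] (G : SimpleGraph V) (s : Set V) (v : s)
    [Fintype ((G.induce s).neighborSet v)] :
    (G.induce s).degree v = #{u | G.Adj v u ∧ u ∈ s} := by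
  rw [← SimpleGraph.card_neighborFinset_eq_degree,
    ← Finset.card_map (Function.Embedding.subtype (· ∈ s))]
  congr 1
  ext u
  simp

lemma jval_induce {V : Type*} [Fintype V] (G : SimpleGraph V) (B s : Set V) [Fintype s]
    (hB : ∀ u v, G.Adj u v → (u ∈ B ↔ v ∉ B)) :
    jval (G.induce s) = (∏ v with v ∈ s, if #{u | G.Adj v u ∧ u ∈ s} = 0 then 2 else 1) *
      ∏ v with v ∈ B ∧ v ∈ s, ∏ u with G.Adj v u ∧ u ∈ s,
        degWeight #{x | G.Adj v x ∧ x ∈ s} #{x | G.Adj u x ∧ x ∈ s} := by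
  rw [jval_eq (G.induce s) (Subtype.val ⁻¹' B) fun u v h => hB u v h]
  simp only [degree_induce_eq_card]
  congr 1
  · exact (Finset.prod_subtype _ (by simp)
      (fun v => if #{u | G.Adj v u ∧ u ∈ s} = 0 then (2 : ℝ) else 1)).symm
  · refine Finset.prod_bij (fun v _ => v.1) (by simp) (by simp) (by simp +contextual) ?_
    intro v _
    exact Finset.prod_bij (fun u _ => u.1) (by simp) (by simp) (by simp +contextual) (by simp)

/-- **Key inequality of Sah–Sawhney–Stoner–Zhao.** If `G` is a connected bipartite graph
with at least two vertices and `w` is a vertex of maximum degree, then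
`j(G - w) + j(G - w - N(w)) ≤ j(G)`, where deletion is taking induced subgraphs. -/
theorem jval_recursion {V : Type*} [Fintype V] (G : SimpleGraph V)
    (hconn : G.Connected) (hbip : G.Colorable 2) (hcard : 2 ≤ Fintype.card V)
    (w : V) (hw : ∀ v : V, G.degree v ≤ G.degree w) :
    jval (G.induce {v | v ≠ w}) + jval (G.induce {v | v ≠ w ∧ ¬ G.Adj w v}) ≤ jval G := by
  obtain ⟨C⟩ := hbip
  obtain ⟨B, hwB, hB⟩ : ∃ B : Set V, w ∈ B ∧ ∀ u v, G.Adj u v → (u ∈ B ↔ v ∉ B) := by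
    refine ⟨{v | C v = C w}, rfl, fun u v h => ?_⟩
    have := C.valid h
    simp only [Set.mem_ofPred_eq]
    omega
  have hnotw : ∀ v ∈ B, ¬ G.Adj w v := fun v hv h => (hB w v h).1 hwB hv
  have hpos := degree_pos_of_connected hconn hcard
  have hdeg : ∀ v, G.degree v = #{u | G.Adj v u} := fun v => by
    rw [← SimpleGraph.card_neighborFinset_eq_degree, SimpleGraph.neighborFinset_eq_filter]
  let B' : Finset V := {v | v ∈ B ∧ v ≠ w}
  let N : Finset V := {u | G.Adj w u}
  let T : V → Finset V := fun u => {v | G.Adj u v ∧ v ≠ w}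
  let U : V → Finset V := fun v => {u | G.Adj v u ∧ ¬ G.Adj w u}
  let P : V → Finset V := fun v => {u | G.Adj v u ∧ G.Adj w u}
  let R : ℝ := ∏ v ∈ B', ∏ u ∈ U v, degWeight (G.degree v) (G.degree u)
  have hR : 0 < R := Finset.prod_pos fun v _ => Finset.prod_pos fun u _ => degWeight_pos _ _
  have hT : ∀ u ∈ N, G.degree u = #(T u) + 1 := fun u hu => by
    have hu' : G.Adj w u := by simpa [N] using hu
    have : ({v | G.Adj u v} : Finset V) = insert w (T u) := by
      ext v
      by_cases hv : v = w
      · simp [hv, hu'.symm]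
      · simp [T, hv]
    rw [hdeg, this, Finset.card_insert_of_notMem (by simp [T])]
  have hPU : ∀ v, #(P v) = G.degree v - #(U v) := fun v => by
    have := Finset.card_filter_add_card_filter_not (s := ({u | G.Adj v u} : Finset V))
      (fun u => G.Adj w u)
    rw [Finset.filter_filter, Finset.filter_filter, ← hdeg] at this
    exact Nat.eq_sub_of_add_eq this
  have hUle : ∀ v, #(U v) ≤ G.degree v := fun v => by
    rw [hdeg]
    exact Finset.card_le_card fun u hu => by simp_all [U]
  have hsplit : ∀ v (F : V → ℝ), ∏ u with G.Adj v u, F u = (∏ u ∈ P v, F u) * ∏ u ∈ U v, F u :=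
    fun v F => by
      rw [← Finset.prod_filter_mul_prod_filter_not _ (fun u => G.Adj w u), Finset.filter_filter,
        Finset.filter_filter]
  have hswap : ∀ F : V → V → ℝ, ∏ v ∈ B', ∏ u ∈ P v, F v u = ∏ u ∈ N, ∏ v ∈ T u, F v u := by
    intro F
    refine Finset.prod_comm' fun v u => ?_
    simp only [B', P, N, T, mem_filter, mem_univ, true_and]
    constructor
    · rintro ⟨⟨_, h1⟩, h2, h3⟩
      exact ⟨⟨h2.symm, h1⟩, h3⟩
    · rintro ⟨⟨h2, h1⟩, h3⟩
      exact ⟨⟨(hB v u h2.symm).2 ((hB w u h3).1 hwB), h1⟩, h2.symm, h3⟩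
  have hG : jval G = R * ∏ u ∈ N, (degWeight (G.degree w) (#(T u) + 1) *
      ∏ v ∈ T u, degWeight (#(T u) + 1) (G.degree v)) := by
    have hins : ({v | v ∈ B} : Finset V) = insert w B' := by
      ext v
      by_cases hv : v = w
      · simp [hv, hwB]
      · simp [B', hv]
    rw [jval_eq G B hB, Finset.prod_eq_one fun v _ => if_neg (by have := hpos v; omega), one_mul,
      hins, Finset.prod_insert (by simp [B'])]
    simp only [hsplit _ _]
    rw [Finset.prod_mul_distrib, hswap, Finset.prod_mul_distrib, ← hsplit]
    have e1 : ∏ u ∈ N, degWeight (G.degree w) (G.degree u) =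
        ∏ u ∈ N, degWeight (G.degree w) (#(T u) + 1) :=
      Finset.prod_congr rfl fun u hu => by rw [hT u hu]
    have e2 : ∏ u ∈ N, ∏ v ∈ T u, degWeight (G.degree v) (G.degree u) =
        ∏ u ∈ N, ∏ v ∈ T u, degWeight (#(T u) + 1) (G.degree v) :=
      Finset.prod_congr rfl fun u hu => Finset.prod_congr rfl fun v _ => by
        rw [degWeight_comm, hT u hu]
    rw [← e1, ← e2]
    ring
  have hG1 : jval (G.induce {v | v ≠ w}) = R * ∏ u ∈ N, ((if #(T u) = 0 then 2 else 1) *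
      ∏ v ∈ T u, degWeight #(T u) (G.degree v)) := by
    have hTU : ∀ u, ¬ G.Adj w u → #(T u) = G.degree u := fun u hu => by
      rw [hdeg]
      congr 1
      ext v
      simp only [T, mem_filter, mem_univ, true_and, and_iff_left_iff_imp]
      rintro h rfl
      exact hu h.symm
    have hTB : ∀ v ∈ B', T v = ({u | G.Adj v u} : Finset V) := fun v hv => by
      ext u
      simp only [T, mem_filter, mem_univ, true_and, and_iff_left_iff_imp]
      rintro h rfl
      simp only [B', mem_filter, mem_univ, true_and] at hv
      exact hnotw v hv.1 h.symm
    rw [jval_induce G B _ hB]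
    simp only [Set.mem_ofPred_eq]
    have e1 : (∏ v with v ≠ w, if #(T v) = 0 then (2 : ℝ) else 1) =
        ∏ u ∈ N, if #(T u) = 0 then (2 : ℝ) else 1 := by
      symm
      refine Finset.prod_subset (fun u hu => ?_) fun u _ hu => if_neg ?_
      · simp only [N, mem_filter, mem_univ, true_and] at hu ⊢
        exact hu.ne'
      · simp only [N, mem_filter, mem_univ, true_and] at hu
        have := hpos u
        rw [hTU u hu]
        omega
    have e2 : (∏ v ∈ B', ∏ u ∈ T v, degWeight #(T v) #(T u)) =
        (∏ u ∈ N, ∏ v ∈ T u, degWeight #(T u) (G.degree v)) * R := by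
      simp only [degWeight_comm #(T _) (G.degree _)]
      rw [← hswap (fun v u => degWeight (G.degree v) #(T u)), ← Finset.prod_mul_distrib]
      refine Finset.prod_congr rfl fun v hv => ?_
      rw [hTB v hv, ← hdeg, hsplit]
      congr 1
      refine Finset.prod_congr rfl fun u hu => ?_
      rw [hTU u (mem_filter.1 hu).2.2]
    rw [Finset.prod_mul_distrib, ← e1, mul_left_comm, mul_comm R, ← e2]
  have hG2 : jval (G.induce {v | v ≠ w ∧ ¬ G.Adj w v}) ≤
      R * ∏ u ∈ N, ∏ v ∈ T u, (2 : ℝ) ^ ((1 : ℝ) / G.degree v) := by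
    rw [jval_induce G B _ hB]
    simp only [Set.mem_ofPred_eq]
    let S : V → Finset V := fun v => {u | G.Adj v u ∧ u ≠ w ∧ ¬ G.Adj w u}
    have hSB : ∀ v ∈ B, S v = U v := fun v hv => by
      ext u
      simp only [S, U, mem_filter, mem_univ, true_and]
      refine and_congr_right fun h => and_iff_right ?_
      rintro rfl
      exact hnotw v hv h.symm
    have hSdeg : ∀ u, u ∉ B → ¬ G.Adj w u → #(S u) = G.degree u := fun u hu hwu => by
      rw [hdeg]
      congr 1
      ext v
      simp only [S, mem_filter, mem_univ, true_and, and_iff_left_iff_imp]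
      refine fun h => ⟨?_, hnotw v ((hB v u h.symm).2 hu)⟩
      rintro rfl
      exact hwu h.symm
    have hB'eq : ({v | v ∈ B ∧ v ≠ w ∧ ¬ G.Adj w v} : Finset V) = B' := by
      ext v
      simp only [B', mem_filter, mem_univ, true_and]
      exact ⟨fun h => ⟨h.1, h.2.1⟩, fun h => ⟨h.1, h.2, hnotw v h.1⟩⟩
    have e1 : (∏ v with v ≠ w ∧ ¬ G.Adj w v, if #(S v) = 0 then (2 : ℝ) else 1) =
        ∏ v ∈ B', if #(S v) = 0 then (2 : ℝ) else 1 := by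
      symm
      refine Finset.prod_subset (fun v hv => ?_) fun v hv hvB => if_neg ?_
      · simp only [B', mem_filter, mem_univ, true_and] at hv ⊢
        exact ⟨hv.2, hnotw v hv.1⟩
      · simp only [B', mem_filter, mem_univ, true_and] at hv hvB
        have := hpos v
        rw [hSdeg v (fun h => hvB ⟨h, hv.1⟩) hv.2]
        omega
    have e2 : R * ∏ u ∈ N, ∏ v ∈ T u, (2 : ℝ) ^ ((1 : ℝ) / G.degree v) =
        ∏ v ∈ B', (((2 : ℝ) ^ ((1 : ℝ) / G.degree v)) ^ (G.degree v - #(U v)) *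
          ∏ u ∈ U v, degWeight (G.degree v) (G.degree u)) := by
      rw [← hswap (fun v _ => (2 : ℝ) ^ ((1 : ℝ) / G.degree v)), Finset.prod_mul_distrib, mul_comm]
      congr 1
      exact Finset.prod_congr rfl fun v _ => by rw [Finset.prod_const, hPU]
    rw [e2, hB'eq]
    refine (congrArg₂ (· * ·) e1 rfl).trans_le ?_
    rw [← Finset.prod_mul_distrib]
    refine Finset.prod_le_prod (fun v _ => mul_nonneg (by split_ifs <;> norm_num)
      (Finset.prod_nonneg fun u _ => (degWeight_pos _ _).le)) fun v hv => ?_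
    have hvB : v ∈ B := by
      simp only [B', mem_filter, mem_univ, true_and] at hv
      exact hv.1
    refine le_of_eq_of_le ?_ (reduced_vertex_contribution (U v) (fun u => G.degree u)
      (fun u _ => hpos u) (hpos v) (hUle v))
    change (if #(S v) = 0 then (2 : ℝ) else 1) * ∏ u ∈ S v, degWeight #(S v) #(S u) = _
    rw [hSB v hvB]
    congr 1
    refine Finset.prod_congr rfl fun u hu => ?_
    simp only [U, mem_filter, mem_univ, true_and] at hu
    rw [hSdeg u ((hB v u hu.1).1 hvB) hu.2]
  have hNcard : #N = G.degree w := (hdeg w).symm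
  have hmain := prod_add_prod_le_prod N
    (Finset.card_pos.1 (by have := hpos w; omega))
    (fun u => (if #(T u) = 0 then 2 else 1) * ∏ v ∈ T u, degWeight #(T u) (G.degree v))
    (fun u => ∏ v ∈ T u, (2 : ℝ) ^ ((1 : ℝ) / G.degree v))
    (fun u => degWeight (G.degree w) (#(T u) + 1) *
      ∏ v ∈ T u, degWeight (#(T u) + 1) (G.degree v))
    (fun u _ => mul_nonneg (by split_ifs <;> norm_num)
      (Finset.prod_nonneg fun v _ => (degWeight_pos _ _).le))
    (fun u _ => Finset.prod_nonneg fun v _ => by positivity)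
    (fun u _ => mul_pos (degWeight_pos _ _) (Finset.prod_pos fun v _ => degWeight_pos _ _))
    (fun u _ => by
      rw [hNcard]
      exact neighbor_contribution (T u) (fun v => G.degree v) (fun v _ => hpos v)
        (fun v _ => hw v) (hpos w))
  calc _ ≤ _ := add_le_add hG1.le hG2
    _ = R * _ := (mul_add _ _ _).symm
    _ ≤ _ := mul_le_mul_of_nonneg_left hmain hR.le
    _ = _ := hG.symm
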